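/- arXiv:2403.17445 — 3 statements merged into one kernel-verified Lean document; each statement's English description precedes it below -/
import Mathlib

section
/- There exists a constant M ≥ 0 such that for all a, b ∈ ℝ with λ' = a + b·i ∈ S (i.e. Re(exp λ') < 0 and |Im(exp λ')| ≤ π), the partial derivative with respect to the real part, deriv (fun s : ℝ => F(s + b·i)) evaluated at a, satisfies |∂F/∂a (λ')| ≤ M. (Proposition 1, real-part case: the gradient of the real part of λ' = log log λ is bounded for all λ in the punctured open unit disc.) -/
/-- If `w` lies in the half strip `Re w < 0`, `|Im w| ≤ π` and `Re α > 0`, then `k w exp (k α w)`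
is bounded independently of `w`. -/
lemma norm_natCast_mul_mul_exp_le {α w : ℂ} (hα : 0 < α.re) (hre : w.re < 0)
    (him : |w.im| ≤ Real.pi) (k : ℕ) :
    ‖(k : ℂ) * w * Complex.exp ((k : ℂ) * α * w)‖ ≤
      (1 / α.re + k * Real.pi) * Real.exp (k * (|α.im| * Real.pi)) := by
  have hk : (0 : ℝ) ≤ k := k.cast_nonneg
  have hw : ‖w‖ ≤ -w.re + Real.pi := by
    have := Complex.norm_le_abs_re_add_abs_im w
    rw [abs_of_neg hre] at this
    linarith
  have hexp : ((k : ℂ) * α * w).re ≤ k * (α.re * w.re) + k * (|α.im| * Real.pi) := by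
    have him' : -(α.im * w.im) ≤ |α.im| * Real.pi :=
      (neg_le_abs _).trans (by rw [abs_mul]; gcongr)
    have : ((k : ℂ) * α * w).re = k * (α.re * w.re) + k * (-(α.im * w.im)) := by
      simp [Complex.mul_re, Complex.mul_im]
      ring
    rw [this]
    gcongr
  have hle_one : Real.exp (k * (α.re * w.re)) ≤ 1 :=
    Real.exp_le_one_iff.2 (mul_nonpos_of_nonneg_of_nonpos hk (mul_neg_of_pos_of_neg hα hre).le)
  have hdecay : k * -w.re * Real.exp (k * (α.re * w.re)) ≤ 1 / α.re := by
    rw [le_div_iff₀ hα]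
    calc k * -w.re * Real.exp (k * (α.re * w.re)) * α.re
        = -(k * (α.re * w.re)) * Real.exp (k * (α.re * w.re)) := by ring
      _ ≤ Real.exp (-(k * (α.re * w.re))) * Real.exp (k * (α.re * w.re)) := by
        gcongr
        linarith [Real.add_one_le_exp (-(k * (α.re * w.re)))]
      _ = 1 := by rw [← Real.exp_add]; simp
  calc ‖(k : ℂ) * w * Complex.exp ((k : ℂ) * α * w)‖
      = k * ‖w‖ * Real.exp ((k : ℂ) * α * w).re := by
        rw [norm_mul, norm_mul, Complex.norm_natCast, Complex.norm_exp]
    _ ≤ k * (-w.re + Real.pi) *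
          Real.exp (k * (α.re * w.re) + k * (|α.im| * Real.pi)) := by
        have := (norm_nonneg w).trans hw
        gcongr
    _ = (k * -w.re * Real.exp (k * (α.re * w.re)) +
          k * Real.pi * Real.exp (k * (α.re * w.re))) * Real.exp (k * (|α.im| * Real.pi)) := by
        rw [Real.exp_add]; ring
    _ ≤ (1 / α.re + k * Real.pi) * Real.exp (k * (|α.im| * Real.pi)) := by
        refine mul_le_mul_of_nonneg_right (add_le_add hdecay ?_) (Real.exp_pos _).le
        exact mul_le_of_le_one_right (by positivity) hle_one

/-- The derivative of `exp (j α w) (1 - exp (α w)) γ` with respect to `z`, where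
`w = exp (z + d)`. -/
lemma hasDerivAt_exp_mul_one_sub_exp (α γ d z : ℂ) (j : ℕ) :
    HasDerivAt (fun z : ℂ => Complex.exp ((j : ℂ) * α * Complex.exp (z + d)) *
        (1 - Complex.exp (α * Complex.exp (z + d))) * γ)
      (((j : ℂ) * Complex.exp (z + d) * Complex.exp ((j : ℂ) * α * Complex.exp (z + d)) -
        ((j + 1 : ℕ) : ℂ) * Complex.exp (z + d) *
          Complex.exp (((j + 1 : ℕ) : ℂ) * α * Complex.exp (z + d))) * (α * γ)) z := by
  have hw : HasDerivAt (fun z : ℂ => Complex.exp (z + d)) (Complex.exp (z + d)) z := by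
    simpa using ((hasDerivAt_id z).add_const d).cexp
  have h := (((hw.const_mul ((j : ℂ) * α)).cexp.mul
    ((hw.const_mul α).cexp.const_sub 1)).mul_const γ)
  refine h.congr_deriv ?_
  have hsplit : Complex.exp (((j + 1 : ℕ) : ℂ) * α * Complex.exp (z + d)) =
      Complex.exp ((j : ℂ) * α * Complex.exp (z + d)) *
        Complex.exp (α * Complex.exp (z + d)) := by
    rw [← Complex.exp_add]
    push_cast
    ring_nf
  rw [hsplit]
  push_cast
  ring


/-- Proposition 1, real-part case: with `λ = exp (exp λ')` (so `λ' = log log λ`),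
`y'_t(λ') = Σ_{j=0}^{t} exp(j·α·exp λ')·(1 − exp(α·exp λ'))·β·x_{t−j}` and
`F(λ') = Σ_{t=1}^{L} c_t · Re(y'_t(λ'))`, the partial derivative of `F` with respect to
the real part of `λ' = a + b·i` is bounded uniformly over the domain
`S = {λ' : Re (exp λ') < 0 ∧ |Im (exp λ')| ≤ π}` (i.e. over `λ` in the punctured open
unit disc). -/
theorem gradient_real_part_bounded
    (L : ℕ) (x c : ℕ → ℝ) (α β : ℂ) (hα : 0 < α.re) :
    ∃ M : ℝ, 0 ≤ M ∧ ∀ a b : ℝ,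
      (Complex.exp (a + b * Complex.I)).re < 0 →
      |(Complex.exp (a + b * Complex.I)).im| ≤ Real.pi →
      |deriv (fun s : ℝ =>
        ∑ t ∈ Finset.Icc 1 L, c t *
          (∑ j ∈ Finset.range (t + 1),
            Complex.exp ((j : ℂ) * α * Complex.exp ((s : ℂ) + (b : ℂ) * Complex.I)) *
              (1 - Complex.exp (α * Complex.exp ((s : ℂ) + (b : ℂ) * Complex.I))) *
              β * (x (t - j) : ℂ)).re) a| ≤ M := by
  set C : ℕ → ℝ := fun k =>
    (1 / α.re + k * Real.pi) * Real.exp (k * (|α.im| * Real.pi))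
  have hC_nonneg (k : ℕ) : 0 ≤ C k := by positivity
  refine ⟨∑ t ∈ Finset.Icc 1 L, |c t| *
    ∑ j ∈ Finset.range (t + 1), (C j + C (j + 1)) * ‖α * (β * (x (t - j) : ℂ))‖,
    Finset.sum_nonneg fun t _ => mul_nonneg (abs_nonneg _) <| Finset.sum_nonneg fun j _ =>
      mul_nonneg (add_nonneg (hC_nonneg _) (hC_nonneg _)) (norm_nonneg _), ?_⟩
  intro a b hre him
  have hderiv := HasDerivAt.fun_sum (u := Finset.Icc 1 L) fun t _ =>
    (HasDerivAt.real_of_complex (HasDerivAt.fun_sum (u := Finset.range (t + 1)) fun j _ =>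
      hasDerivAt_exp_mul_one_sub_exp α (β * (x (t - j) : ℂ)) (b * Complex.I) (a : ℂ) j)).const_mul
        (c t)
  simp only [← mul_assoc _ β] at hderiv
  rw [hderiv.deriv]
  refine (Finset.abs_sum_le_sum_abs _ _).trans (Finset.sum_le_sum fun t _ => ?_)
  rw [abs_mul]
  gcongr
  refine (Complex.abs_re_le_norm _).trans (norm_sum_le_of_le _ fun j _ => ?_)
  simp only [mul_assoc α β]
  rw [norm_mul]
  gcongr
  exact (norm_sub_le _ _).trans (add_le_add (norm_natCast_mul_mul_exp_le hα hre him j)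
    (norm_natCast_mul_mul_exp_le hα hre him (j + 1)))
end

section
/- There exists a constant M ≥ 0 such that for all a, b ∈ ℝ with λ' = a + b·i ∈ S (i.e. Re(exp λ') < 0 and |Im(exp λ')| ≤ π), the partial derivative with respect to the imaginary part, deriv (fun s : ℝ => F(a + s·i)) evaluated at b, satisfies |∂F/∂b (λ')| ≤ M. (Proposition 1, imaginary-part case: the gradient of the imaginary part of λ' = log log λ is bounded for all λ in the punctured open unit disc.) -/
/-- The family of curves `f a : ℝ → E` is differentiable, with uniformly bounded derivative, at
all `b` for which `exp (a + b * I)` lies in the half-strip `Re < 0`, `|Im| ≤ π`. -/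
def HasBoundedDerivOnHalfStrip {E : Type*} [NormedAddCommGroup E] [NormedSpace ℝ E]
    (f : ℝ → ℝ → E) : Prop :=
  ∃ M : ℝ, 0 ≤ M ∧ ∀ a b : ℝ,
    (Complex.exp (a + b * Complex.I)).re < 0 →
    |(Complex.exp (a + b * Complex.I)).im| ≤ Real.pi →
    ∃ d : E, HasDerivAt (f a) d b ∧ ‖d‖ ≤ M

namespace HasBoundedDerivOnHalfStrip

variable {E F : Type*} [NormedAddCommGroup E] [NormedSpace ℝ E]
  [NormedAddCommGroup F] [NormedSpace ℝ F]

theorem const (e : E) : HasBoundedDerivOnHalfStrip (fun _ _ => e) :=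
  ⟨0, le_rfl, fun _ b _ _ => ⟨0, hasDerivAt_const b e, norm_zero.le⟩⟩

theorem sub {f g : ℝ → ℝ → E} (hf : HasBoundedDerivOnHalfStrip f)
    (hg : HasBoundedDerivOnHalfStrip g) :
    HasBoundedDerivOnHalfStrip (fun a s => f a s - g a s) := by
  obtain ⟨M, hM, hf⟩ := hf
  obtain ⟨N, hN, hg⟩ := hg
  refine ⟨M + N, by positivity, fun a b hre him => ?_⟩
  obtain ⟨d, hd, hdM⟩ := hf a b hre him
  obtain ⟨e, he, heN⟩ := hg a b hre him
  exact ⟨d - e, hd.sub he, (norm_sub_le d e).trans (add_le_add hdM heN)⟩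

theorem sum {ι : Type*} (u : Finset ι) {f : ι → ℝ → ℝ → E}
    (hf : ∀ i ∈ u, HasBoundedDerivOnHalfStrip (f i)) :
    HasBoundedDerivOnHalfStrip (fun a s => ∑ i ∈ u, f i a s) := by
  choose! M hM hf using hf
  refine ⟨∑ i ∈ u, M i, Finset.sum_nonneg hM, fun a b hre him => ?_⟩
  choose! d hd hdM using fun i hi => hf i hi a b hre him
  exact ⟨∑ i ∈ u, d i, HasDerivAt.fun_sum hd, norm_sum_le_of_le u hdM⟩

theorem clm_comp (T : E →L[ℝ] F) {f : ℝ → ℝ → E} (hf : HasBoundedDerivOnHalfStrip f) :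
    HasBoundedDerivOnHalfStrip (fun a s => T (f a s)) := by
  obtain ⟨M, hM, hf⟩ := hf
  refine ⟨‖T‖ * M, by positivity, fun a b hre him => ?_⟩
  obtain ⟨d, hd, hdM⟩ := hf a b hre him
  exact ⟨T d, T.hasFDerivAt.comp_hasDerivAt b hd, T.le_opNorm_of_le hdM⟩

end HasBoundedDerivOnHalfStrip

theorem norm_mul_mul_exp_le_of_mem_halfStrip {w z : ℂ} (hw : 0 < w.re) (hre : z.re < 0)
    (him : |z.im| ≤ Real.pi) :
    ‖w * z * Complex.exp (w * z)‖ ≤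
      ‖w‖ * ((1 / w.re + Real.pi) * Real.exp (|w.im| * Real.pi)) := by
  have hz : ‖z‖ ≤ -z.re + Real.pi :=
    (Complex.norm_le_abs_re_add_abs_im z).trans
      (add_le_add (abs_of_neg hre).le him)
  have hwz : -(w.im * z.im) ≤ |w.im| * Real.pi :=
    (neg_le_abs _).trans ((abs_mul _ _).trans_le
      (mul_le_mul_of_nonneg_left him (abs_nonneg _)))
  have hexp : ‖Complex.exp (w * z)‖ ≤
      Real.exp (w.re * z.re) * Real.exp (|w.im| * Real.pi) := by
    rw [Complex.norm_exp, ← Real.exp_add, Complex.mul_re]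
    exact Real.exp_le_exp.2 (by linarith)
  have hlin : -z.re * Real.exp (w.re * z.re) ≤ 1 / w.re := by
    rw [le_div_iff₀ hw]
    have h := Real.add_one_le_exp (-(w.re * z.re))
    calc -z.re * Real.exp (w.re * z.re) * w.re
        = -(w.re * z.re) * Real.exp (w.re * z.re) := by ring
      _ ≤ Real.exp (-(w.re * z.re)) * Real.exp (w.re * z.re) := by gcongr; linarith
      _ = 1 := by rw [← Real.exp_add, neg_add_cancel, Real.exp_zero]
  have hone : Real.exp (w.re * z.re) ≤ 1 :=
    Real.exp_le_one_iff.2 (mul_nonpos_of_nonneg_of_nonpos hw.le hre.le)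
  rw [norm_mul, norm_mul, mul_assoc]
  refine mul_le_mul_of_nonneg_left ?_ (norm_nonneg w)
  calc ‖z‖ * ‖Complex.exp (w * z)‖
      ≤ (-z.re + Real.pi) * (Real.exp (w.re * z.re) * Real.exp (|w.im| * Real.pi)) :=
        mul_le_mul hz hexp (norm_nonneg _) ((norm_nonneg z).trans hz)
    _ = (-z.re * Real.exp (w.re * z.re) + Real.pi * Real.exp (w.re * z.re)) *
          Real.exp (|w.im| * Real.pi) := by ring
    _ ≤ (1 / w.re + Real.pi) * Real.exp (|w.im| * Real.pi) := by
        gcongr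
        exact mul_le_of_le_one_right Real.pi_pos.le hone

theorem hasBoundedDerivOnHalfStrip_exp {w : ℂ} (hw : 0 < w.re) :
    HasBoundedDerivOnHalfStrip (fun a s : ℝ =>
      Complex.exp (w * Complex.exp ((a : ℂ) + (s : ℂ) * Complex.I))) := by
  refine ⟨‖w‖ * ((1 / w.re + Real.pi) * Real.exp (|w.im| * Real.pi)),
    by have := Real.pi_pos; positivity, fun a b hre him => ?_⟩
  set z := Complex.exp (a + b * Complex.I) with hz
  have hline : HasDerivAt (fun s : ℝ => (a : ℂ) + (s : ℂ) * Complex.I) Complex.I b := by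
    simpa using ((Complex.ofRealCLM.hasDerivAt (x := b)).mul_const Complex.I).const_add (a : ℂ)
  refine ⟨_, (hline.cexp.const_mul w).cexp, ?_⟩
  rw [← hz]
  have h := norm_mul_mul_exp_le_of_mem_halfStrip hw hre him
  have heq : Complex.exp (w * z) * (w * (z * Complex.I)) =
      w * z * Complex.exp (w * z) * Complex.I := by ring
  rwa [heq, norm_mul, Complex.norm_I, mul_one]

theorem hasBoundedDerivOnHalfStrip_exp_natCast_mul {α : ℂ} (hα : 0 < α.re) (j : ℕ) :
    HasBoundedDerivOnHalfStrip (fun a s : ℝ =>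
      Complex.exp ((j : ℂ) * α * Complex.exp ((a : ℂ) + (s : ℂ) * Complex.I))) := by
  rcases j.eq_zero_or_pos with rfl | hj
  · simpa using HasBoundedDerivOnHalfStrip.const (1 : ℂ)
  · refine hasBoundedDerivOnHalfStrip_exp ?_
    rw [← Complex.ofReal_natCast, Complex.re_ofReal_mul]
    positivity

/-- Proposition 1, imaginary-part case: with `λ = exp (exp λ')` (so `λ' = log log λ`),
`y'_t(λ') = Σ_{j=0}^{t} exp(j·α·exp λ')·(1 − exp(α·exp λ'))·β·x_{t−j}` and
`F(λ') = Σ_{t=1}^{L} c_t · Re(y'_t(λ'))`, the partial derivative of `F` with respect to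
the imaginary part of `λ' = a + b·i` is bounded uniformly over the domain
`S = {λ' : Re (exp λ') < 0 ∧ |Im (exp λ')| ≤ π}` (i.e. over `λ` in the punctured open
unit disc). -/
theorem gradient_imaginary_part_bounded
    (L : ℕ) (x c : ℕ → ℝ) (α β : ℂ) (hα : 0 < α.re) :
    ∃ M : ℝ, 0 ≤ M ∧ ∀ a b : ℝ,
      (Complex.exp (a + b * Complex.I)).re < 0 →
      |(Complex.exp (a + b * Complex.I)).im| ≤ Real.pi →
      |deriv (fun s : ℝ =>
        ∑ t ∈ Finset.Icc 1 L, c t *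
          (∑ j ∈ Finset.range (t + 1),
            Complex.exp ((j : ℂ) * α * Complex.exp ((a : ℂ) + (s : ℂ) * Complex.I)) *
              (1 - Complex.exp (α * Complex.exp ((a : ℂ) + (s : ℂ) * Complex.I))) *
              β * (x (t - j) : ℂ)).re) b| ≤ M := by
  have hterm (j : ℕ) (γ : ℂ) : HasBoundedDerivOnHalfStrip (fun a s : ℝ =>
      Complex.exp ((j : ℂ) * α * Complex.exp ((a : ℂ) + (s : ℂ) * Complex.I)) *
        (1 - Complex.exp (α * Complex.exp ((a : ℂ) + (s : ℂ) * Complex.I))) * β * γ) := by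
    convert ((hasBoundedDerivOnHalfStrip_exp_natCast_mul hα j).sub
      (hasBoundedDerivOnHalfStrip_exp_natCast_mul hα (j + 1))).clm_comp
        (ContinuousLinearMap.mul ℝ ℂ (β * γ)) using 3 with a s
    have hsucc (z : ℂ) : ((j + 1 : ℕ) : ℂ) * α * z = (j : ℂ) * α * z + α * z := by
      push_cast
      ring
    rw [ContinuousLinearMap.mul_apply', hsucc, Complex.exp_add (_ * _ * _)]
    ring
  obtain ⟨M, hM, h⟩ := HasBoundedDerivOnHalfStrip.sum (Finset.Icc 1 L) fun t _ =>
    ((HasBoundedDerivOnHalfStrip.sum (Finset.range (t + 1)) fun j _ =>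
      hterm j (x (t - j) : ℂ)).clm_comp Complex.reCLM).clm_comp
        (ContinuousLinearMap.mul ℝ ℝ (c t))
  refine ⟨M, hM, fun a b hre him => ?_⟩
  obtain ⟨d, hd, hdM⟩ := h a b hre him
  exact (congrArg abs hd.deriv).trans_le hdM
end

section
/- The gradient expression vanishes at the origin: the function λ ↦ Σ_{t=1}^{L} c_t · Re(Σ_{j=0}^{t} β · x_{t−j} · α · λ^{α·j} · (j − (j+1)·λ^{α}) · Log λ) tends to 0 as λ → 0 along nonzero complex λ. (This is the boundary claim lim_{λ→0} dL/da = 0 used in the proof of Proposition 1.) -/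
open Filter Topology in
/-- A complex power with exponent of positive real part tends to `0` at the origin. -/
lemma tendsto_cpow_nhdsNE_zero {s : ℂ} (hs : 0 < s.re) :
    Tendsto (fun z : ℂ => z ^ s) (𝓝[≠] 0) (𝓝 0) := by
  have hs0 : s ≠ 0 := by
    rintro rfl
    simp at hs
  have h : Tendsto (fun z : ℂ => z ^ s) (𝓝 0) (𝓝 (0 ^ s)) :=
    (Complex.continuousAt_cpow_zero_of_re_pos hs).tendsto.comp
      (tendsto_id.prodMk_nhds tendsto_const_nhds)
  rw [Complex.zero_cpow hs0] at h
  exact h.mono_left nhdsWithin_le_nhds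

open Filter Topology in
/-- A complex power with exponent of positive real part beats the logarithm at the origin. -/
lemma tendsto_cpow_mul_log_nhdsNE_zero {s : ℂ} (hs : 0 < s.re) :
    Tendsto (fun z : ℂ => z ^ s * Complex.log z) (𝓝[≠] 0) (𝓝 0) := by
  have hnorm : Tendsto (fun z : ℂ => ‖z‖) (𝓝[≠] 0) (𝓝[>] 0) := tendsto_norm_nhdsNE_zero
  have hlog : Tendsto (fun z : ℂ => (z ^ s * (Real.log ‖z‖ : ℂ))) (𝓝[≠] 0) (𝓝 0) := by
    have hb := ((tendsto_log_mul_rpow_nhdsGT_zero hs).comp hnorm).norm.mul_const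
      (Real.exp (Real.pi * |s.im|))
    rw [norm_zero, zero_mul] at hb
    refine squeeze_zero_norm (fun z => ?_) hb
    have harg : -(Complex.arg z * s.im) ≤ Real.pi * |s.im| :=
      (neg_le_abs _).trans <| by
        rw [abs_mul]
        exact mul_le_mul_of_nonneg_right (Complex.abs_arg_le_pi z) (abs_nonneg _)
    have hpow : ‖z ^ s‖ ≤ ‖z‖ ^ s.re * Real.exp (Real.pi * |s.im|) := by
      refine (Complex.norm_cpow_le z s).trans ?_
      rw [div_eq_mul_inv, ← Real.exp_neg]
      gcongr
    calc ‖z ^ s * (Real.log ‖z‖ : ℂ)‖ = ‖z ^ s‖ * |Real.log ‖z‖| := by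
          rw [norm_mul, Complex.norm_real, Real.norm_eq_abs]
      _ ≤ ‖z‖ ^ s.re * Real.exp (Real.pi * |s.im|) * |Real.log ‖z‖| := by gcongr
      _ = ‖Real.log ‖z‖ * ‖z‖ ^ s.re‖ * Real.exp (Real.pi * |s.im|) := by
          rw [norm_mul, Real.norm_eq_abs, Real.norm_of_nonneg (by positivity)]
          ring
  have harg : Tendsto (fun z : ℂ => z ^ s * (Complex.arg z * Complex.I)) (𝓝[≠] 0) (𝓝 0) := by
    have hb := (tendsto_cpow_nhdsNE_zero hs).norm.mul_const Real.pi
    rw [norm_zero, zero_mul] at hb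
    refine squeeze_zero_norm (fun z => ?_) hb
    rw [norm_mul, norm_mul, Complex.norm_I, mul_one, Complex.norm_real, Real.norm_eq_abs]
    exact mul_le_mul_of_nonneg_left (Complex.abs_arg_le_pi z) (norm_nonneg _)
  simpa only [Complex.log, mul_add, add_zero] using hlog.add harg


/-- Boundary claim `lim_{λ→0} dL/da = 0` in the proof of Proposition 1: the function
`λ ↦ Σ_{t=1}^{L} c_t · Re(Σ_{j=0}^{t} β·x_{t−j}·α·λ^{α·j}·(j − (j+1)·λ^{α})·Log λ)`
tends to `0` as `λ → 0` along nonzero complex `λ`. -/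
theorem gradient_expression_tendsto_zero_at_origin
    (L : ℕ) (x c : ℕ → ℝ) (α β : ℂ) (hα : 0 < α.re) :
    Filter.Tendsto (fun z : ℂ =>
        ∑ t ∈ Finset.Icc 1 L, c t *
          (∑ j ∈ Finset.range (t + 1),
            β * (x (t - j) : ℂ) * α * z ^ (α * (j : ℂ)) *
              ((j : ℂ) - ((j : ℂ) + 1) * z ^ α) * Complex.log z).re)
      (nhdsWithin 0 {0}ᶜ) (nhds 0) := by
  have hterm (a : ℂ) (j : ℕ) : Filter.Tendsto (fun z : ℂ =>
      a * z ^ (α * (j : ℂ)) * ((j : ℂ) - ((j : ℂ) + 1) * z ^ α) * Complex.log z)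
      (nhdsWithin 0 {0}ᶜ) (nhds 0) := by
    rcases Nat.eq_zero_or_pos j with rfl | hj
    · simpa [mul_assoc] using (tendsto_cpow_mul_log_nhdsNE_zero hα).const_mul (-a)
    · have hre : 0 < (α * (j : ℂ)).re := by
        rw [← Complex.ofReal_natCast, Complex.re_mul_ofReal]
        positivity
      have hfactor := ((tendsto_cpow_nhdsNE_zero hα).const_mul ((j : ℂ) + 1)).const_sub (j : ℂ)
      have h := ((tendsto_cpow_mul_log_nhdsNE_zero hre).mul hfactor).const_mul a
      rw [zero_mul, mul_zero] at h
      exact h.congr fun z => by ring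
  have hinner (t : ℕ) := tendsto_finsetSum (Finset.range (t + 1)) fun j _ =>
    hterm (β * (x (t - j) : ℂ) * α) j
  have houter := tendsto_finsetSum (Finset.Icc 1 L) fun t _ =>
    ((Complex.continuous_re.tendsto _).comp (hinner t)).const_mul (c t)
  simpa only [Function.comp_def, Finset.sum_const_zero, Complex.zero_re, mul_zero] using houter
end
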